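/- (Lower bound of the mass density at far field.) Let ρ̄ > 0, R > 1 and C̄ > 0 be constants, and let 0 < T̄ ≤ T satisfy C̄·T̄ ≤ R/2. Assume: (i) (3/8)ρ̄ ≤ ρ₀(x) ≤ (5/2)ρ̄ for all x with |x| ≥ R/2; (ii) |w(s,y)| ≤ C̄ for all (s,y) ∈ [0,T] × ℝ³; (iii) ∫₀^{T̄} sup_{y∈ℝ³} |div w(s,y)| ds ≤ ln 2. Then for all (t,x) ∈ [0,T̄] × ℝ³ with |x| ≥ R one has (3/16)ρ̄ ≤ ρ(t,x) ≤ 5ρ̄. (Indeed, the backward characteristic stays in {|y| ≥ R/2}, so ρ₀(U(0;t,x)) ∈ [(3/8)ρ̄, (5/2)ρ̄], and the exponential factor lies in [1/2, 2].) -/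

import Mathlib

open MeasureTheory Set

noncomputable section

/-- The divergence of a vector field on `ℝ³`. -/
def div3 (f : EuclideanSpace ℝ (Fin 3) → EuclideanSpace ℝ (Fin 3))
    (x : EuclideanSpace ℝ (Fin 3)) : ℝ :=
  ∑ i, fderiv ℝ (fun y => f y i) x (EuclideanSpace.single i 1)

/-- Lower bound of the mass density at far field: if
`(3/8)ρ̄ ≤ ρ₀ ≤ (5/2)ρ̄` for `|x| ≥ R/2`, `|w| ≤ C̄` on `[0,T] × ℝ³`,
`C̄·T̄ ≤ R/2` and `∫₀^{T̄} sup_y |div w(s,y)| ds ≤ ln 2`, then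
`(3/16)ρ̄ ≤ ρ(t,x) ≤ 5ρ̄` for all `t ∈ [0,T̄]` and `|x| ≥ R`. -/
theorem far_field_density_bound
    (T : ℝ) (hT : 0 < T)
    (w : ℝ → EuclideanSpace ℝ (Fin 3) → EuclideanSpace ℝ (Fin 3))
    (hw : ContDiff ℝ 1 (fun p : ℝ × EuclideanSpace ℝ (Fin 3) => w p.1 p.2))
    (hwb : ∃ M, ∀ t ∈ Set.Icc 0 T, ∀ x, ‖fderiv ℝ (w t) x‖ ≤ M)
    (U : ℝ → ℝ → EuclideanSpace ℝ (Fin 3) → EuclideanSpace ℝ (Fin 3))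
    (hU0 : ∀ t x, U t t x = x)
    (hU : ∀ s t x, HasDerivAt (fun s' => U s' t x) (w s (U s t x)) s)
    (ρ₀ : EuclideanSpace ℝ (Fin 3) → ℝ) (hρ₀ : ContDiff ℝ 1 ρ₀)
    (ρ : ℝ → EuclideanSpace ℝ (Fin 3) → ℝ)
    (hρ : ∀ t x, ρ t x =
      ρ₀ (U 0 t x) * Real.exp (-∫ s in (0:ℝ)..t, div3 (w s) (U s t x)))
    (ρbar R C Tbar : ℝ)
    (hρbar : 0 < ρbar) (hR : 1 < R) (hC : 0 < C)
    (hTbar : 0 < Tbar) (hTbarT : Tbar ≤ T) (hCT : C * Tbar ≤ R / 2)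
    (h1 : ∀ x : EuclideanSpace ℝ (Fin 3), R / 2 ≤ ‖x‖ →
      3 / 8 * ρbar ≤ ρ₀ x ∧ ρ₀ x ≤ 5 / 2 * ρbar)
    (h2 : ∀ s ∈ Set.Icc 0 T, ∀ y, ‖w s y‖ ≤ C)
    (h3int : IntegrableOn (fun s => ⨆ y, |div3 (w s) y|) (Set.Icc 0 Tbar))
    (h3 : (∫ s in (0:ℝ)..Tbar, ⨆ y, |div3 (w s) y|) ≤ Real.log 2) :
    ∀ t ∈ Set.Icc 0 Tbar, ∀ x : EuclideanSpace ℝ (Fin 3), R ≤ ‖x‖ →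
      3 / 16 * ρbar ≤ ρ t x ∧ ρ t x ≤ 5 * ρbar := by
  obtain ⟨M, hM⟩ := hwb
  intro t ht x hx
  have htT : t ≤ T := ht.2.trans hTbarT
  -- boundedness of the divergence
  have hdiv : ∀ s ∈ Set.Icc 0 T, ∀ y, |div3 (w s) y| ≤ 3 * M := by
    intro s hs y
    have hd : DifferentiableAt ℝ (w s) y := by
      have h := (hw.differentiable (by norm_num)).comp
        ((differentiable_const s).prodMk differentiable_id :
          Differentiable ℝ (fun z : EuclideanSpace ℝ (Fin 3) => (s, z)))
      exact h y
    have hterm : ∀ i : Fin 3,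
        |fderiv ℝ (fun y => w s y i) y (EuclideanSpace.single i 1)| ≤ M := by
      intro i
      have hf : HasFDerivAt (fun y => w s y i)
          ((EuclideanSpace.proj i : EuclideanSpace ℝ (Fin 3) →L[ℝ] ℝ).comp
            (fderiv ℝ (w s) y)) y :=
        (EuclideanSpace.proj i : EuclideanSpace ℝ (Fin 3) →L[ℝ] ℝ).hasFDerivAt.comp y
          hd.hasFDerivAt
      rw [hf.fderiv]
      have a1 := PiLp.norm_apply_le
        (fderiv ℝ (w s) y (EuclideanSpace.single i (1:ℝ))) i
      have a2 := (fderiv ℝ (w s) y).le_opNorm (EuclideanSpace.single i (1:ℝ))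
      have a3 := hM s hs y
      have a4 : ‖(EuclideanSpace.single i (1:ℝ) : EuclideanSpace ℝ (Fin 3))‖ = 1 := by simp
      rw [a4, mul_one] at a2
      exact a1.trans (a2.trans a3)
    unfold div3
    refine (Finset.abs_sum_le_sum_abs _ _).trans ?_
    refine (Finset.sum_le_sum (fun i _ => hterm i)).trans ?_
    simp
  have hle : ∀ s ∈ Set.Icc 0 T, ∀ y, |div3 (w s) y| ≤ ⨆ y, |div3 (w s) y| := by
    intro s hs y
    refine le_ciSup (f := fun y => |div3 (w s) y|) ⟨3 * M, ?_⟩ y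
    rintro _ ⟨z, rfl⟩
    exact hdiv s hs z
  -- the exponent
  have hI : |∫ s in (0:ℝ)..t, div3 (w s) (U s t x)| ≤ Real.log 2 := by
    have hint : IntervalIntegrable (fun s => ⨆ y, |div3 (w s) y|) volume 0 Tbar := by
      rw [intervalIntegrable_iff_integrableOn_Icc_of_le hTbar.le]
      exact h3int
    have hint' : IntervalIntegrable (fun s => ⨆ y, |div3 (w s) y|) volume 0 t := by
      rw [intervalIntegrable_iff_integrableOn_Icc_of_le ht.1]
      exact h3int.mono_set (Set.Icc_subset_Icc_right ht.2)
    have b1 : ‖∫ s in (0:ℝ)..t, div3 (w s) (U s t x)‖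
        ≤ ∫ s in (0:ℝ)..t, ⨆ y, |div3 (w s) y| := by
      refine intervalIntegral.norm_integral_le_of_norm_le ht.1 ?_ hint'
      refine Filter.Eventually.of_forall fun s hs => ?_
      exact hle s ⟨hs.1.le, hs.2.trans htT⟩ _
    have b2 : (∫ s in (0:ℝ)..t, ⨆ y, |div3 (w s) y|)
        ≤ ∫ s in (0:ℝ)..Tbar, ⨆ y, |div3 (w s) y| := by
      refine intervalIntegral.integral_mono_interval le_rfl ht.1 ht.2 ?_ hint
      refine Filter.Eventually.of_forall fun s => ?_
      exact Real.iSup_nonneg fun y => abs_nonneg _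
    exact b1.trans (b2.trans h3)
  -- the backward characteristic
  have hdist : ‖U t t x - U 0 t x‖ ≤ C * (t - 0) :=
    norm_image_sub_le_of_norm_deriv_le_segment' (f := fun s => U s t x)
      (fun s _ => (hU s t x).hasDerivWithinAt)
      (fun s hs => h2 s ⟨hs.1, hs.2.le.trans htT⟩ _) t ⟨ht.1, le_rfl⟩
  rw [hU0, sub_zero] at hdist
  have hCt : C * t ≤ R / 2 := (mul_le_mul_of_nonneg_left ht.2 hC.le).trans hCT
  have hnorm : R / 2 ≤ ‖U 0 t x‖ := by
    have := norm_sub_norm_le x (U 0 t x)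
    linarith
  obtain ⟨hl, hu⟩ := h1 _ hnorm
  obtain ⟨hIl, hIu⟩ := abs_le.mp hI
  have he1 : (1/2 : ℝ) ≤ Real.exp (-∫ s in (0:ℝ)..t, div3 (w s) (U s t x)) := by
    have h : Real.exp (-Real.log 2) = 1/2 := by
      rw [Real.exp_neg, Real.exp_log (by norm_num)]; norm_num
    rw [← h]
    exact Real.exp_le_exp.mpr (by linarith)
  have he2 : Real.exp (-∫ s in (0:ℝ)..t, div3 (w s) (U s t x)) ≤ 2 := by
    have h : Real.exp (Real.log 2) = 2 := Real.exp_log (by norm_num)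
    calc _ ≤ Real.exp (Real.log 2) := Real.exp_le_exp.mpr (by linarith)
      _ = 2 := h
  rw [hρ]
  generalize Real.exp (-∫ s in (0:ℝ)..t, div3 (w s) (U s t x)) = e at he1 he2
  have hp : 0 < ρ₀ (U 0 t x) := by linarith
  constructor
  · nlinarith
  · nlinarith
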